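/- There exists a constant C > 0 such that for all N ≥ 1 and all s with 1/2 ≤ s < 1, |h(1, s, N) − ( N(s−1) + N(N−1)(1−s)² )| ≤ C · N³ (1−s)³. -/

import Mathlib

open MeasureTheory Real Filter

noncomputable section

/-- The joint eigenangle density of `SO(2N+1)` on `[0,π]^N`. -/
def densitySO (N : ℕ) (θ : Fin N → ℝ) : ℝ :=
  (2 ^ (N ^ 2) / (π ^ N * N.factorial)) *
    (∏ j : Fin N, ∏ k ∈ Finset.Ioi j, (Real.cos (θ k) - Real.cos (θ j)) ^ 2) *
    ∏ m : Fin N, Real.sin (θ m / 2) ^ 2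

/-- `h(n, s, N)`: the `n`-th moment of the eigenvalue sum against the eigenangle density. -/
def hFun (n : ℕ) (s : ℝ) (N : ℕ) : ℝ :=
  ∫ θ in Set.univ.pi fun _ : Fin N => Set.Icc (0 : ℝ) π,
    ((s - 1) * ∑ j, (2 * s - 2 * Real.cos (θ j)) / (1 + s ^ 2 - 2 * s * Real.cos (θ j))) ^ n *
      densitySO N θ

/-- `g(l, s, N)`: the integral of `∏_j ((1-s)² + 4s sin²(θ_j/2))^{-l_j}` against the
eigenangle density. -/
def gFun (N : ℕ) (l : Fin N → ℕ) (s : ℝ) : ℝ :=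
  ∫ θ in Set.univ.pi fun _ : Fin N => Set.Icc (0 : ℝ) π,
    (∏ j, ((1 - s) ^ 2 + 4 * s * Real.sin (θ j / 2) ^ 2) ^ (-(l j : ℤ))) * densitySO N θ

/-- One-point case of Andréief's identity for an orthonormal family. -/
lemma integral_sum_mul_det_sq {N : ℕ} {μ : Measure ℝ} [SigmaFinite μ] {φ : Fin N → ℝ → ℝ}
    {f : ℝ → ℝ} (hφ : ∀ a b, Integrable (fun x => φ a x * φ b x) μ)
    (hf : ∀ a b, Integrable (fun x => f x * (φ a x * φ b x)) μ)
    (horth : ∀ a b, ∫ x, φ a x * φ b x ∂μ = if a = b then 1 else 0) :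
    ∫ θ : Fin N → ℝ, (∑ j, f (θ j)) * (Matrix.of fun i k => φ k (θ i)).det ^ 2
      ∂(Measure.pi fun _ => μ) = N.factorial * ∑ k, ∫ x, f x * φ k x ^ 2 ∂μ := by
  classical
  let G : Fin N → Equiv.Perm (Fin N) → Equiv.Perm (Fin N) → Fin N → ℝ → ℝ := fun j σ τ i x =>
    (if i = j then f x else 1) * (φ (σ i) x * φ (τ i) x)
  have hG : ∀ j σ τ i, Integrable (G j σ τ i) μ := by
    intro j σ τ i
    by_cases h : i = j
    · simpa [G, h] using hf (σ j) (τ j)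
    · simpa [G, h] using hφ (σ i) (τ i)
  have hprod : ∀ j σ τ, ∏ i, ∫ x, G j σ τ i x ∂μ =
      if σ = τ then ∫ x, f x * φ (σ j) x ^ 2 ∂μ else 0 := by
    intro j σ τ
    split_ifs with h
    · subst h
      rw [Finset.prod_eq_single j]
      · simp [G, sq]
      · intro i _ hij
        simp [G, hij, horth]
      · simp
    · obtain ⟨i, hij, hi⟩ : ∃ i, i ≠ j ∧ σ i ≠ τ i := by
        by_contra! hall
        have hmul : ∀ i, i ≠ j → (τ⁻¹ * σ) i = i := fun i hi => by simp [hall i hi]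
        have hfix : (τ⁻¹ * σ) j = j := by
          by_contra hj
          exact hj ((τ⁻¹ * σ).injective (hmul _ hj))
        apply h
        ext i
        by_cases hi : i = j
        · subst hi
          rw [Equiv.Perm.mul_apply, Equiv.Perm.inv_eq_iff_eq] at hfix
          rw [hfix]
        · rw [hall i hi]
      refine Finset.prod_eq_zero (Finset.mem_univ i) ?_
      simp [G, hij, horth, hi]
  have hexp : ∀ θ : Fin N → ℝ, (∑ j, f (θ j)) * (Matrix.of fun i k => φ k (θ i)).det ^ 2 =
      ∑ j, ∑ σ : Equiv.Perm (Fin N), ∑ τ : Equiv.Perm (Fin N),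
        (((Equiv.Perm.sign σ : ℤ) : ℝ) * ((Equiv.Perm.sign τ : ℤ) : ℝ)) *
          ∏ i, G j σ τ i (θ i) := by
    intro θ
    rw [← Matrix.det_transpose, Matrix.det_apply', sq, Finset.sum_mul_sum, Finset.sum_mul]
    refine Finset.sum_congr rfl fun j _ => ?_
    rw [Finset.mul_sum]
    refine Finset.sum_congr rfl fun σ _ => ?_
    rw [Finset.mul_sum]
    refine Finset.sum_congr rfl fun τ _ => ?_
    simp only [G, Finset.prod_mul_distrib, Finset.prod_ite_eq', Finset.mem_univ, if_true,
      Matrix.transpose_apply, Matrix.of_apply]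
    ring
  have hint : ∀ j σ τ, Integrable (fun θ : Fin N → ℝ =>
      (((Equiv.Perm.sign σ : ℤ) : ℝ) * ((Equiv.Perm.sign τ : ℤ) : ℝ)) *
          ∏ i, G j σ τ i (θ i)) (Measure.pi fun _ => μ) := fun j σ τ =>
    (Integrable.fintype_prod (hG j σ τ)).const_mul _
  simp_rw [hexp]
  rw [integral_finsetSum _ fun j _ => integrable_finsetSum _ fun σ _ =>
    integrable_finsetSum _ fun τ _ => hint j σ τ]
  simp_rw [integral_finsetSum _ fun σ _ => integrable_finsetSum _ fun τ _ => hint _ σ τ,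
    integral_finsetSum _ fun τ _ => hint _ _ τ, integral_const_mul,
    integral_fintype_prod_eq_prod, hprod]
  have hsign : ∀ σ : Equiv.Perm (Fin N),
      ((Equiv.Perm.sign σ : ℤ) : ℝ) * ((Equiv.Perm.sign σ : ℤ) : ℝ) = 1 := by
    intro σ
    rw [← Int.cast_mul, Int.units_coe_mul_self, Int.cast_one]
  simp only [mul_ite, mul_zero, Finset.sum_ite_eq, Finset.mem_univ, if_true, hsign, one_mul]
  rw [Finset.sum_comm]
  simp_rw [fun σ : Equiv.Perm (Fin N) => Equiv.sum_comp σ fun k => ∫ x, f x * φ k x ^ 2 ∂μ]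
  simp [Fintype.card_perm]

/-- The monic polynomials `q k` with `q k (2 cos θ) = sin ((k + 1/2) θ) / sin (θ / 2)`
(rescaled Chebyshev polynomials of the fourth kind). -/
def chebyshevW : ℕ → Polynomial ℝ
  | 0 => 1
  | 1 => Polynomial.X + 1
  | n + 2 => Polynomial.X * chebyshevW (n + 1) - chebyshevW n

lemma chebyshevW_monic_natDegree (n : ℕ) :
    (chebyshevW n).Monic ∧ (chebyshevW n).natDegree = n := by
  induction n using Nat.twoStepInduction with
  | zero => simp [chebyshevW]
  | one =>
    have h := Polynomial.monic_X_add_C (1 : ℝ)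
    have h' := Polynomial.natDegree_X_add_C (1 : ℝ)
    simpa [chebyshevW] using And.intro h h'
  | more n ih0 ih1 =>
    have hm : (Polynomial.X * chebyshevW (n + 1)).Monic := Polynomial.monic_X.mul ih1.1
    have hd : (Polynomial.X * chebyshevW (n + 1)).natDegree = n + 2 := by
      rw [Polynomial.monic_X.natDegree_mul ih1.1, ih1.2, Polynomial.natDegree_X]
      ring
    have hlt : (chebyshevW n).natDegree < (Polynomial.X * chebyshevW (n + 1)).natDegree := by
      rw [ih0.2, hd]
      lia
    rw [chebyshevW]
    exact ⟨hm.sub_of_left (Polynomial.degree_lt_degree hlt),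
      (Polynomial.natDegree_sub_eq_left_of_natDegree_lt hlt).trans hd⟩

lemma sin_mul_eval_chebyshevW (n : ℕ) (x : ℝ) :
    sin (x / 2) * (chebyshevW n).eval (2 * cos x) = sin ((n + 1 / 2) * x) := by
  induction n using Nat.twoStepInduction with
  | zero => simp [chebyshevW]; ring_nf
  | one =>
    have h : sin ((1 + 1 / 2) * x) = sin (x + x / 2) := by ring_nf
    have hc : cos x = 2 * cos (x / 2) ^ 2 - 1 := by rw [← cos_two_mul]; ring_nf
    have hs : sin x = 2 * sin (x / 2) * cos (x / 2) := by rw [← sin_two_mul]; ring_nf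
    simp only [chebyshevW, Polynomial.eval_add, Polynomial.eval_X, Polynomial.eval_one,
      Nat.cast_one, h, sin_add, hs]
    rw [hc]
    ring
  | more n ih0 ih1 =>
    have h0 : sin ((n + 1 / 2) * x) = sin (((n + 1 : ℕ) + 1 / 2) * x - x) := by
      push_cast; ring_nf
    have h2 : sin (((n + 2 : ℕ) + 1 / 2) * x) = sin (((n + 1 : ℕ) + 1 / 2) * x + x) := by
      push_cast; ring_nf
    rw [chebyshevW, Polynomial.eval_sub, Polynomial.eval_mul, Polynomial.eval_X, h2, sin_add]
    rw [h0, sin_sub] at ih0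
    linear_combination 2 * cos x * ih1 - ih0

/-- The orthonormal family on `[0, π]` underlying the `SO(2N+1)` ensemble. -/
def oddSine (k : ℕ) (x : ℝ) : ℝ := √(2 / π) * sin ((k + 1 / 2) * x)

lemma prod_two_pow_sq (N : ℕ) : (∏ k : Fin N, (2 : ℝ) ^ (k : ℕ)) ^ 2 * 2 ^ N = 2 ^ (N ^ 2) := by
  rw [Fin.prod_univ_eq_prod_range (fun k => (2 : ℝ) ^ k) N]
  induction N with
  | zero => simp
  | succ n ih =>
    rw [Finset.prod_range_succ]
    calc _ = ((∏ k ∈ Finset.range n, (2 : ℝ) ^ k) ^ 2 * 2 ^ n) * 2 ^ (2 * n + 1) := by ring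
      _ = _ := by rw [ih, ← pow_add]; ring_nf

lemma densitySO_eq_det_sq (N : ℕ) (θ : Fin N → ℝ) :
    densitySO N θ =
      (N.factorial : ℝ)⁻¹ * (Matrix.of fun i k : Fin N => oddSine k (θ i)).det ^ 2 := by
  have hdet : (Matrix.of fun i k : Fin N => oddSine k (θ i)).det =
      (∏ i, √(2 / π) * sin (θ i / 2)) * ((∏ k : Fin N, (2 : ℝ) ^ (k : ℕ)) *
        ∏ j : Fin N, ∏ k ∈ Finset.Ioi j, (cos (θ k) - cos (θ j))) := by
    rw [← Matrix.det_vandermonde, ← Matrix.det_mul_row]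
    have hv : (Matrix.of fun i k : Fin N =>
        (2 : ℝ) ^ (k : ℕ) * Matrix.vandermonde (fun i => cos (θ i)) i k) =
        Matrix.vandermonde fun i => 2 * cos (θ i) := by
      ext i k
      simp [Matrix.vandermonde_apply, mul_pow]
    rw [hv, Matrix.det_eval_matrixOfPolynomials_eq_det_vandermonde _
      (fun k : Fin N => chebyshevW k) (fun k => (chebyshevW_monic_natDegree k).2)
      (fun k => (chebyshevW_monic_natDegree k).1), ← Matrix.det_mul_column]
    congr 1
    ext i k
    simp only [Matrix.of_apply, oddSine]
    rw [mul_assoc, sin_mul_eval_chebyshevW]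
  have hpi := pi_pos
  rw [hdet, densitySO, Finset.prod_mul_distrib, Finset.prod_const, Finset.card_univ,
    Fintype.card_fin, ← prod_two_pow_sq]
  simp only [Finset.prod_pow, mul_pow]
  rw [← pow_mul, mul_comm N 2, pow_mul, sq_sqrt (by positivity), div_pow]
  field_simp

lemma integral_cos_nat_mul {n : ℕ} (hn : n ≠ 0) : ∫ x in (0 : ℝ)..π, cos (n * x) = 0 := by
  have hn' : (n : ℝ) ≠ 0 := Nat.cast_ne_zero.mpr hn
  rw [intervalIntegral.integral_comp_mul_left (fun y => cos y) hn', integral_cos]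
  simp [sin_nat_mul_pi]

lemma oddSine_mul (a b : ℕ) (x : ℝ) :
    oddSine a x * oddSine b x = π⁻¹ * (cos (((a : ℝ) - b) * x) - cos ((a + b + 1 : ℕ) * x)) := by
  have h1 : cos (((a : ℝ) - b) * x) = cos ((a + 1 / 2) * x - (b + 1 / 2) * x) := by ring_nf
  have h2 : cos ((a + b + 1 : ℕ) * x) = cos ((a + 1 / 2) * x + (b + 1 / 2) * x) := by
    push_cast; ring_nf
  have h3 : √(2 / π) * √(2 / π) = 2 * π⁻¹ := by
    rw [mul_self_sqrt (by positivity), div_eq_mul_inv]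
  rw [h1, h2, cos_sub, cos_add, oddSine, oddSine]
  linear_combination sin ((a + 1 / 2) * x) * sin ((b + 1 / 2) * x) * h3

lemma integral_oddSine_mul (a b : ℕ) :
    ∫ x in (0 : ℝ)..π, oddSine a x * oddSine b x = if a = b then 1 else 0 := by
  have hcont : ∀ c : ℝ, IntervalIntegrable (fun x => cos (c * x)) volume 0 π := fun c =>
    Continuous.intervalIntegrable (by fun_prop) _ _
  simp_rw [oddSine_mul]
  rw [intervalIntegral.integral_const_mul, intervalIntegral.integral_sub (hcont _) (hcont _),
    integral_cos_nat_mul (Nat.succ_ne_zero _)]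
  split_ifs with h
  · simp [h, pi_ne_zero]
  · rcases lt_or_gt_of_ne h with hlt | hlt
    · have : ∀ x : ℝ, cos (((a : ℝ) - b) * x) = cos ((b - a : ℕ) * x) := fun x => by
        rw [Nat.cast_sub hlt.le, ← cos_neg]; ring_nf
      simp_rw [this]
      rw [integral_cos_nat_mul (Nat.sub_ne_zero_of_lt hlt)]
      simp
    · simp_rw [← Nat.cast_sub hlt.le]
      rw [integral_cos_nat_mul (Nat.sub_ne_zero_of_lt hlt)]
      simp

lemma poisson_denom_pos {s : ℝ} (h0 : 0 < s) (h1 : s < 1) (x : ℝ) :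
    0 < 1 + s ^ 2 - 2 * s * cos x := by
  nlinarith [cos_le_one x, mul_nonneg h0.le (sub_nonneg.mpr (cos_le_one x)),
    pow_pos (sub_pos.mpr h1) 2]

lemma continuous_div_poisson_denom {s : ℝ} (h0 : 0 < s) (h1 : s < 1) {g : ℝ → ℝ}
    (hg : Continuous g) : Continuous fun x => g x / (1 + s ^ 2 - 2 * s * cos x) :=
  hg.div (by fun_prop) fun x => (poisson_denom_pos h0 h1 x).ne'

/-- Fourier coefficients of the Poisson kernel. -/
lemma integral_cos_div_poisson_denom {s : ℝ} (h0 : 0 < s) (h1 : s < 1) (n : ℕ) :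
    ∫ x in (0 : ℝ)..π, cos (n * x) / (1 + s ^ 2 - 2 * s * cos x) =
      π * s ^ n / (1 - s ^ 2) := by
  set J : ℕ → ℝ := fun n => ∫ x in (0 : ℝ)..π, cos (n * x) / (1 + s ^ 2 - 2 * s * cos x) with hJ
  have hint : ∀ n : ℕ, IntervalIntegrable
      (fun x => cos (n * x) / (1 + s ^ 2 - 2 * s * cos x)) volume 0 π := fun n =>
    (continuous_div_poisson_denom h0 h1 (by fun_prop)).intervalIntegrable _ _
  have hzero : (1 + s ^ 2) * J 0 - 2 * s * J 1 = π := by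
    simp only [hJ]
    rw [← intervalIntegral.integral_const_mul, ← intervalIntegral.integral_const_mul,
      ← intervalIntegral.integral_sub ((hint 0).const_mul _) ((hint 1).const_mul _)]
    have : ∀ x : ℝ, (1 + s ^ 2) * (cos ((0 : ℕ) * x) / (1 + s ^ 2 - 2 * s * cos x)) -
        2 * s * (cos ((1 : ℕ) * x) / (1 + s ^ 2 - 2 * s * cos x)) = 1 := fun x => by
      simp only [Nat.cast_zero, zero_mul, cos_zero, Nat.cast_one, one_mul]
      linear_combination mul_inv_cancel₀ (poisson_denom_pos h0 h1 x).ne'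
    simp_rw [this]
    simp
  have hrec : ∀ m, (1 + s ^ 2) * J (m + 1) - s * (J (m + 2) + J m) = 0 := by
    intro m
    rw [← integral_cos_nat_mul (Nat.succ_ne_zero m)]
    simp only [hJ]
    rw [← intervalIntegral.integral_add (hint _) (hint _), ← intervalIntegral.integral_const_mul,
      ← intervalIntegral.integral_const_mul,
      ← intervalIntegral.integral_sub ((hint _).const_mul _) (((hint _).add (hint _)).const_mul _)]
    refine intervalIntegral.integral_congr fun x _ => ?_
    have e2 : cos ((m + 2 : ℕ) * x) = cos ((m + 1 : ℕ) * x + x) := by push_cast; ring_nf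
    have e0 : cos (m * x) = cos ((m + 1 : ℕ) * x - x) := by push_cast; ring_nf
    simp only [e2, e0, cos_add, cos_sub, Nat.succ_eq_add_one]
    linear_combination cos ((m + 1 : ℕ) * x) * mul_inv_cancel₀ (poisson_denom_pos h0 h1 x).ne'
  have hgeom : ∀ m, J 1 - s * J 0 = s ^ m * (J (m + 1) - s * J m) := by
    intro m
    induction m with
    | zero => simp
    | succ m ih =>
      rw [ih, pow_succ]
      linear_combination s ^ m * hrec m
  have hbound : ∀ m, |J m| ≤ J 0 := by
    intro m
    simp only [hJ]
    refine (intervalIntegral.abs_integral_le_integral_abs pi_pos.le).trans ?_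
    refine intervalIntegral.integral_mono_on pi_pos.le (hint m).abs (hint 0) fun x _ => ?_
    have hp := poisson_denom_pos h0 h1 x
    rw [abs_div, abs_of_pos hp]
    gcongr
    simpa using abs_cos_le_one (m * x)
  have hE : J 1 - s * J 0 = 0 := by
    have hlim : Tendsto (fun m : ℕ => s ^ m * (2 * J 0)) atTop (nhds 0) := by
      simpa using (tendsto_pow_atTop_nhds_zero_of_lt_one h0.le h1).mul_const (2 * J 0)
    have hle : ∀ m : ℕ, |J 1 - s * J 0| ≤ s ^ m * (2 * J 0) := by
      intro m
      rw [hgeom m, abs_mul, abs_of_pos (pow_pos h0 m)]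
      gcongr
      have h2 := abs_sub (J (m + 1)) (s * J m)
      rw [abs_mul, abs_of_pos h0] at h2
      nlinarith [hbound (m + 1), hbound m, abs_nonneg (J m)]
    exact abs_nonpos_iff.mp (ge_of_tendsto' hlim hle)
  have hs2 : 1 - s ^ 2 ≠ 0 := by nlinarith
  have hJ0 : J 0 = π / (1 - s ^ 2) := by
    rw [eq_div_iff hs2]
    linear_combination hzero + 2 * s * hE
  have hstep : ∀ m, J (m + 1) = s * J m := by
    intro m
    have h := hgeom m
    rw [hE] at h
    have := (mul_eq_zero.mp h.symm).resolve_left (pow_pos h0 m).ne'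
    linarith
  have hpow : J n = s ^ n * J 0 := by
    induction n with
    | zero => simp
    | succ m ih => rw [hstep, ih, pow_succ]; ring
  change J n = _
  rw [hpow, hJ0]
  ring

/-- The per-angle contribution to `h(1, s, N) / (s - 1)`. -/
def angleTerm (s x : ℝ) : ℝ := (2 * s - 2 * cos x) / (1 + s ^ 2 - 2 * s * cos x)

lemma integral_angleTerm_mul_oddSine_sq {s : ℝ} (h0 : 0 < s) (h1 : s < 1) (k : ℕ) :
    ∫ x in (0 : ℝ)..π, angleTerm s x * oddSine k x ^ 2 = s ^ (2 * k) := by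
  have hint : ∀ n : ℕ, IntervalIntegrable
      (fun x => cos (n * x) / (1 + s ^ 2 - 2 * s * cos x)) volume 0 π := fun n =>
    (continuous_div_poisson_denom h0 h1 (by fun_prop)).intervalIntegrable _ _
  have hexp : ∀ x, angleTerm s x * oddSine k x ^ 2 = (s * π)⁻¹ *
      ((1 - cos ((2 * k + 1 : ℕ) * x)) - (1 - s ^ 2) *
        (cos ((0 : ℕ) * x) / (1 + s ^ 2 - 2 * s * cos x) -
          cos ((2 * k + 1 : ℕ) * x) / (1 + s ^ 2 - 2 * s * cos x))) := by
    intro x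
    have hne := (poisson_denom_pos h0 h1 x).ne'
    have hpi := pi_ne_zero
    rw [sq, oddSine_mul, angleTerm, ← two_mul k]
    simp only [sub_self, zero_mul, Nat.cast_zero, cos_zero]
    field_simp
    ring
  simp_rw [hexp]
  have hcos : IntervalIntegrable (fun x => cos ((2 * k + 1 : ℕ) * x)) volume 0 π :=
    Continuous.intervalIntegrable (by fun_prop) _ _
  rw [intervalIntegral.integral_const_mul, intervalIntegral.integral_sub
    (intervalIntegrable_const.sub hcos) (((hint 0).sub (hint _)).const_mul _),
    intervalIntegral.integral_sub intervalIntegrable_const hcos,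
    intervalIntegral.integral_const_mul, intervalIntegral.integral_sub (hint 0) (hint _),
    integral_cos_nat_mul (Nat.succ_ne_zero _), integral_cos_div_poisson_denom h0 h1,
    integral_cos_div_poisson_denom h0 h1, intervalIntegral.integral_const]
  have hs2 : 1 - s ^ 2 ≠ 0 := by nlinarith
  have hpi := pi_ne_zero
  simp only [smul_eq_mul]
  field_simp
  ring

/-- Second-order Taylor bound for powers of `1 - ε`. -/
lemma abs_one_sub_pow_sub_le {ε : ℝ} (h0 : 0 ≤ ε) (h1 : ε ≤ 1) (n : ℕ) :
    |(1 - ε) ^ n - (1 - n * ε)| ≤ (n : ℝ) ^ 2 / 2 * ε ^ 2 := by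
  have hlow : ∀ m : ℕ, 0 ≤ (1 - ε) ^ m - (1 - m * ε) := by
    intro m
    have := one_add_mul_le_pow (a := -ε) (by linarith) m
    rw [← sub_eq_add_neg] at this
    linarith
  rw [abs_of_nonneg (hlow n)]
  induction n with
  | zero => simp
  | succ m ih =>
    rw [pow_succ]
    push_cast
    nlinarith [hlow m, mul_nonneg h0 (hlow m), sq_nonneg ε]

lemma hFun_one_eq {s : ℝ} (h0 : 0 < s) (h1 : s < 1) (N : ℕ) :
    hFun 1 s N = (s - 1) * ∑ k : Fin N, s ^ (2 * (k : ℕ)) := by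
  have hsine : ∀ k, Continuous (oddSine k) := fun k => by
    unfold oddSine
    fun_prop
  have hterm : Continuous (angleTerm s) := continuous_div_poisson_denom h0 h1 (by fun_prop)
  have hIcc : ∀ g : ℝ → ℝ, ∫ x in Set.Icc 0 π, g x = ∫ x in (0 : ℝ)..π, g x := fun g => by
    rw [intervalIntegral.integral_of_le pi_pos.le, integral_Icc_eq_integral_Ioc]
  have key := integral_sum_mul_det_sq (N := N) (μ := volume.restrict (Set.Icc 0 π))
    (φ := fun k => oddSine k) (f := angleTerm s)
    (fun a b => ((hsine a).mul (hsine b)).integrableOn_Icc)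
    (fun a b => (hterm.mul ((hsine a).mul (hsine b))).integrableOn_Icc)
    (fun a b => by rw [hIcc, integral_oddSine_mul]; simp [Fin.ext_iff])
  simp_rw [hIcc, integral_angleTerm_mul_oddSine_sq h0 h1] at key
  have hfac : (N.factorial : ℝ) ≠ 0 := Nat.cast_ne_zero.mpr N.factorial_ne_zero
  have hintegrand : ∀ θ : Fin N → ℝ,
      ((s - 1) * ∑ j, (2 * s - 2 * cos (θ j)) / (1 + s ^ 2 - 2 * s * cos (θ j))) ^ 1 *
        densitySO N θ = ((s - 1) * (N.factorial : ℝ)⁻¹) * ((∑ j, angleTerm s (θ j)) *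
          (Matrix.of fun i k : Fin N => oddSine k (θ i)).det ^ 2) := fun θ => by
    rw [densitySO_eq_det_sq]
    simp only [angleTerm]
    ring
  rw [hFun]
  simp_rw [hintegrand]
  rw [integral_const_mul, volume_pi, Measure.restrict_pi_pi, key]
  field_simp

/-- Asymptotics of `h(1, s, N)`:  `h(1,s,N) = N(s-1) + N(N-1)(1-s)² + O(N³(1-s)³)`. -/
theorem hFun_one_asymptotics :
    ∃ C : ℝ, 0 < C ∧ ∀ (N : ℕ), 1 ≤ N → ∀ (s : ℝ), 1 / 2 ≤ s → s < 1 →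
      |hFun 1 s N - ((N : ℝ) * (s - 1) + (N : ℝ) * ((N : ℝ) - 1) * (1 - s) ^ 2)| ≤
        C * (N : ℝ) ^ 3 * (1 - s) ^ 3 := by
  refine ⟨2, by norm_num, fun N hN s hs h1 => ?_⟩
  clear hN
  have h0 : 0 < s := by linarith
  rw [hFun_one_eq h0 h1, Fin.sum_univ_eq_sum_range (fun k => s ^ (2 * k)) N]
  have hlin : ∑ k ∈ Finset.range N, (1 - ((2 * k : ℕ) : ℝ) * (1 - s)) =
      N - N * ((N : ℝ) - 1) * (1 - s) := by
    induction N with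
    | zero => simp
    | succ n ih =>
      rw [Finset.sum_range_succ, ih]
      push_cast
      ring
  have hbound : ∀ k ∈ Finset.range N,
      |s ^ (2 * k) - (1 - ((2 * k : ℕ) : ℝ) * (1 - s))| ≤ 2 * (N : ℝ) ^ 2 * (1 - s) ^ 2 := by
    intro k hk
    have h := abs_one_sub_pow_sub_le (ε := 1 - s) (by linarith) (by linarith) (2 * k)
    rw [sub_sub_cancel] at h
    refine h.trans ?_
    have hkN : (k : ℝ) ≤ N := Nat.cast_le.mpr (Finset.mem_range.mp hk).le
    have hsq : (k : ℝ) ^ 2 ≤ (N : ℝ) ^ 2 := by gcongr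
    have : ((2 * k : ℕ) : ℝ) ^ 2 / 2 ≤ 2 * (N : ℝ) ^ 2 := by
      push_cast
      linarith
    gcongr
  have hsum : |∑ k ∈ Finset.range N, (s ^ (2 * k) - (1 - ((2 * k : ℕ) : ℝ) * (1 - s)))| ≤
      N * (2 * (N : ℝ) ^ 2 * (1 - s) ^ 2) := by
    refine (Finset.abs_sum_le_sum_abs _ _).trans ((Finset.sum_le_sum hbound).trans ?_)
    simp
  rw [Finset.sum_sub_distrib, hlin] at hsum
  have hfactor : (s - 1) * ∑ k ∈ Finset.range N, s ^ (2 * k) -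
      (N * (s - 1) + N * ((N : ℝ) - 1) * (1 - s) ^ 2) =
      (s - 1) * (∑ k ∈ Finset.range N, s ^ (2 * k) - (N - N * ((N : ℝ) - 1) * (1 - s))) := by
    ring
  rw [hfactor, abs_mul, abs_sub_comm s 1, abs_of_pos (sub_pos.mpr h1)]
  calc _ ≤ (1 - s) * (N * (2 * (N : ℝ) ^ 2 * (1 - s) ^ 2)) := by
        gcongr
    _ = _ := by ring
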